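/- For any N ≥ 1, any N distinct real numbers E₁,…,E_N and any θ₁,…,θ_N ∈ [0,π], there exists a function q ∈ C^∞([0,∞)) such that limsup_{x→∞} x^{1-α/2}·|q(x)| ≤ (2-α)·e^{2√(ln N)}·N and, for each j = 1,…,N, the perturbed Stark eigen-equation -u'' - x^α·u + q·u = E_j·u has an L²(ℝ⁺) solution u satisfying the boundary condition u'(0)·cos θ_j = u(0)·sin θ_j. -/

import Mathlib

open Filter MeasureTheory Set Real


structure StGood {N : ℕ} (F : ℝ → (Fin N → ℝ) → ℝ) : Prop where
  cont : ∀ x, Continuous (fun t => F t x)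
  bd : ∀ T : ℝ, ∃ C : ℝ, 0 ≤ C ∧ ∀ t, |t| ≤ T → ∀ x y, |F t x| ≤ C ∧ |F t x - F t y| ≤ C * ‖x - y‖

lemma StGood.of_cont {N : ℕ} {f : ℝ → ℝ} (hf : Continuous f) :
    StGood (fun t (_ : Fin N → ℝ) => f t) := by
  refine ⟨fun _ => hf, fun T => ?_⟩
  obtain ⟨C, hC⟩ := (isCompact_Icc (a := -T) (b := T)).exists_bound_of_continuousOn hf.continuousOn
  refine ⟨|C|, abs_nonneg _, fun t ht x y => ⟨?_, ?_⟩⟩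
  · exact (hC t (abs_le.1 ht)).trans (le_abs_self _)
  · simp; positivity

lemma StGood.mul {N : ℕ} {F G : ℝ → (Fin N → ℝ) → ℝ} (hF : StGood F) (hG : StGood G) :
    StGood (fun t x => F t x * G t x) := by
  refine ⟨fun x => (hF.cont x).mul (hG.cont x), fun T => ?_⟩
  obtain ⟨C, hC0, hC⟩ := hF.bd T
  obtain ⟨D, hD0, hD⟩ := hG.bd T
  refine ⟨C * D + C * D, by positivity, fun t ht x y => ⟨?_, ?_⟩⟩
  · rw [abs_mul]
    have := mul_le_mul (hC t ht x y).1 (hD t ht x y).1 (abs_nonneg _) hC0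
    nlinarith [mul_nonneg hC0 hD0]
  · have e : F t x * G t x - F t y * G t y = F t x * (G t x - G t y) + (F t x - F t y) * G t y := by
      ring
    rw [e]
    refine (abs_add_le _ _).trans ?_
    rw [abs_mul, abs_mul]
    have h1 := mul_le_mul (hC t ht x y).1 (hD t ht x y).2 (abs_nonneg _) hC0
    have h2 := mul_le_mul (hC t ht x y).2 (hD t ht y y).1 (abs_nonneg _) (by positivity)
    nlinarith

lemma StGood.add {N : ℕ} {F G : ℝ → (Fin N → ℝ) → ℝ} (hF : StGood F) (hG : StGood G) :
    StGood (fun t x => F t x + G t x) := by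
  refine ⟨fun x => (hF.cont x).add (hG.cont x), fun T => ?_⟩
  obtain ⟨C, hC0, hC⟩ := hF.bd T
  obtain ⟨D, hD0, hD⟩ := hG.bd T
  refine ⟨C + D, by positivity, fun t ht x y => ⟨?_, ?_⟩⟩
  · exact (abs_add_le _ _).trans (add_le_add (hC t ht x y).1 (hD t ht x y).1)
  · have e : F t x + G t x - (F t y + G t y) = (F t x - F t y) + (G t x - G t y) := by
      ring
    rw [e, add_mul]
    exact (abs_add_le _ _).trans (add_le_add (hC t ht x y).2 (hD t ht x y).2)

lemma StGood.sum {N : ℕ} {ι : Type*} (s : Finset ι) {F : ι → ℝ → (Fin N → ℝ) → ℝ}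
    (hF : ∀ i, StGood (F i)) : StGood (fun t x => ∑ i ∈ s, F i t x) := by
  classical
  induction s using Finset.induction_on with
  | empty => simpa using StGood.of_cont (N := N) (continuous_const (y := (0:ℝ)))
  | insert a s ha ih =>
    simp only [Finset.sum_insert ha]
    exact (hF a).add ih

lemma StGood.sin {N : ℕ} (i : Fin N) : StGood (fun _ (x : Fin N → ℝ) => Real.sin (x i)) := by
  refine ⟨fun x => continuous_const, fun T => ⟨1, zero_le_one, fun t _ x y => ⟨abs_sin_le_one _, ?_⟩⟩⟩
  have h1 := Real.lipschitzWith_sin.dist_le_mul (x i) (y i)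
  have h2 := norm_le_pi_norm (x - y) i
  simp only [Real.dist_eq, NNReal.coe_one, Pi.sub_apply, Real.norm_eq_abs] at h1 h2
  linarith

lemma StGood.cos {N : ℕ} (i : Fin N) : StGood (fun _ (x : Fin N → ℝ) => Real.cos (x i)) := by
  refine ⟨fun x => continuous_const, fun T => ⟨1, zero_le_one, fun t _ x y => ⟨abs_cos_le_one _, ?_⟩⟩⟩
  have h1 := Real.lipschitzWith_cos.dist_le_mul (x i) (y i)
  have h2 := norm_le_pi_norm (x - y) i
  simp only [Real.dist_eq, NNReal.coe_one, Pi.sub_apply, Real.norm_eq_abs] at h1 h2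
  linarith

lemma st_global_ode {N : ℕ} (v : ℝ → (Fin N → ℝ) → (Fin N → ℝ))
    (hv : ∀ j, StGood (fun t x => v t x j)) (x0 : Fin N → ℝ) :
    ∃ φ : ℝ → (Fin N → ℝ), φ 0 = x0 ∧ ∀ t, HasDerivAt φ (v t (φ t)) t := by
  have key : ∀ T : ℝ, ∃ C : ℝ, 0 ≤ C ∧ ∀ t, |t| ≤ T → ∀ x y, ‖v t x‖ ≤ C ∧
      ‖v t x - v t y‖ ≤ C * ‖x - y‖ := by
    intro T
    choose C hC0 hC using fun j => (hv j).bd T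
    have hle : ∀ j, C j ≤ ∑ i, C i := fun j =>
      Finset.single_le_sum (fun i _ => hC0 i) (Finset.mem_univ j)
    have hs : 0 ≤ ∑ i, C i := Finset.sum_nonneg (fun i _ => hC0 i)
    refine ⟨∑ i, C i, hs, fun t ht x y => ⟨?_, ?_⟩⟩
    · refine (pi_norm_le_iff_of_nonneg hs).2 fun j => ?_
      exact ((hC j t ht x y).1).trans (hle j)
    · refine (pi_norm_le_iff_of_nonneg (by positivity)).2 fun j => ?_
      exact ((hC j t ht x y).2).trans (mul_le_mul_of_nonneg_right (hle j) (norm_nonneg _))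
  have loc : ∀ n : ℕ, ∃ f : ℝ → (Fin N → ℝ), f 0 = x0 ∧
      ∀ t ∈ Ioo (-(n:ℝ)) n, HasDerivAt f (v t (f t)) t := by
    intro n
    obtain ⟨C, hC0, hC⟩ := key n
    have h0 : (0:ℝ) ∈ Icc (-(n:ℝ)) n := ⟨by simp, by simp⟩
    have hP : IsPicardLindelof v (tmin := -(n:ℝ)) (tmax := n) ⟨0, h0⟩ x0 (C.toNNReal * n) 0
        C.toNNReal C.toNNReal := by
      constructor
      · intro t ht
        refine LipschitzOnWith.of_dist_le_mul fun x _ y _ => ?_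
        rw [dist_eq_norm, dist_eq_norm, Real.coe_toNNReal _ hC0]
        exact (hC t (abs_le.2 ht) x y).2
      · intro x _
        refine Continuous.continuousOn ?_
        exact continuous_pi fun j => (hv j).cont x
      · intro t ht x _
        rw [Real.coe_toNNReal _ hC0]
        exact (hC t (abs_le.2 ht) x x).1
      · simp
    obtain ⟨f, hf0, hf⟩ := hP.exists_eq_forall_mem_Icc_hasDerivWithinAt₀
    refine ⟨f, hf0, fun t ht => ?_⟩
    exact (hf t ⟨ht.1.le, ht.2.le⟩).hasDerivAt (Icc_mem_nhds ht.1 ht.2)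
  choose f hf0 hf using loc
  have uniq : ∀ n m : ℕ, n ≤ m → ∀ t ∈ Ioo (-(n:ℝ)) n, f n t = f m t := by
    intro n m hnm t ht
    obtain ⟨C, hC0, hC⟩ := key n
    have hnm' : (n:ℝ) ≤ m := by exact_mod_cast hnm
    have hn0 : (0:ℝ) < n := by linarith [ht.1, ht.2]
    refine ODE_solution_unique_of_mem_Ioo (v := v) (s := fun _ => univ) (K := C.toNNReal) (t₀ := 0)
      (a := -(n:ℝ)) (b := n) ?_ ⟨by linarith, hn0⟩ (fun t ht => ⟨hf n t ht, trivial⟩)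
      (fun t ht => ⟨hf m t ⟨by linarith [ht.1], by linarith [ht.2]⟩, trivial⟩)
      ((hf0 n).trans (hf0 m).symm) ht
    intro t ht
    refine LipschitzOnWith.of_dist_le_mul fun x _ y _ => ?_
    rw [dist_eq_norm, dist_eq_norm, Real.coe_toNNReal _ hC0]
    exact (hC t (abs_le.2 ⟨ht.1.le, ht.2.le⟩) x y).2
  have hmem : ∀ t : ℝ, t ∈ Ioo (-((⌈|t|⌉₊ + 1 : ℕ):ℝ)) ((⌈|t|⌉₊ + 1 : ℕ):ℝ) := by
    intro t
    have := Nat.le_ceil |t|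
    have h2 := abs_le.1 this
    push_cast
    constructor <;> linarith [h2.1, h2.2]
  refine ⟨fun t => f (⌈|t|⌉₊ + 1) t, hf0 _, fun t => ?_⟩
  refine (hf _ t (hmem t)).congr_of_eventuallyEq ?_
  filter_upwards [Ioo_mem_nhds (hmem t).1 (hmem t).2] with s hs
  rcases le_total (⌈|s|⌉₊ + 1) (⌈|t|⌉₊ + 1) with h | h
  · exact uniq _ _ h s (hmem s)
  · exact (uniq _ _ h s hs).symm


lemma st_prufer (s s' φ w : ℝ → ℝ) (hs : ∀ x, HasDerivAt s (s' x) x) (hs' : Continuous s')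
    (hpos : ∀ x, 0 < s x) (hw : Continuous w)
    (hφ : ∀ x, HasDerivAt φ (s x ^ 2 * cos (φ x) ^ 2 + w x / s x ^ 2 * sin (φ x) ^ 2
      + 2 * (s' x / s x) * (sin (φ x) * cos (φ x))) x) :
    ∃ L u : ℝ → ℝ, (∀ x, u x = exp (L x) * sin (φ x) / s x) ∧
      (∀ x, HasDerivAt L (-(s' x / s x) * (cos (φ x) ^ 2 - sin (φ x) ^ 2)
        + (s x ^ 2 - w x / s x ^ 2) * (sin (φ x) * cos (φ x))) x) ∧
      ContDiff ℝ 2 u ∧ (∀ x, deriv u x = exp (L x) * s x * cos (φ x)) ∧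
      (∀ x, deriv (deriv u) x = - w x * u x) ∧ (∃ x ∈ Ici (0:ℝ), u x ≠ 0) := by
  have hsc : Continuous s := continuous_iff_continuousAt.2 fun x => (hs x).continuousAt
  have hφc : Continuous φ := continuous_iff_continuousAt.2 fun x => (hφ x).continuousAt
  have hne : ∀ x, s x ≠ 0 := fun x => (hpos x).ne'
  set ρ : ℝ → ℝ := fun x => -(s' x / s x) * (cos (φ x) ^ 2 - sin (φ x) ^ 2)
        + (s x ^ 2 - w x / s x ^ 2) * (sin (φ x) * cos (φ x)) with hρ
  have hρc : Continuous ρ := by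
    have h1 : Continuous fun x => s' x / s x := hs'.div hsc hne
    have h2 : Continuous fun x => w x / s x ^ 2 := hw.div (hsc.pow 2) (fun x => pow_ne_zero 2 (hne x))
    fun_prop
  set L : ℝ → ℝ := fun x => ∫ t in (0:ℝ)..x, ρ t with hL
  have hLd : ∀ x, HasDerivAt L (ρ x) x := fun x =>
    intervalIntegral.integral_hasDerivAt_right (hρc.intervalIntegrable _ _)
      (hρc.stronglyMeasurableAtFilter _ _) hρc.continuousAt
  have hLc : Continuous L := continuous_iff_continuousAt.2 fun x => (hLd x).continuousAt
  set u : ℝ → ℝ := fun x => exp (L x) * sin (φ x) / s x with hu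
  set v : ℝ → ℝ := fun x => exp (L x) * s x * cos (φ x) with hv
  have hud : ∀ x, HasDerivAt u (v x) x := by
    intro x
    have := (((hLd x).exp.mul (hφ x).sin).div (hs x) (hne x))
    refine this.congr_deriv ?_
    have h1 := hne x
    have h2 : sin (φ x) ^ 2 = 1 - cos (φ x) ^ 2 := sin_sq _
    simp only [hρ, hv, Pi.mul_apply]
    field_simp
    have h3 : sin (φ x) ^ 3 = sin (φ x) * (1 - cos (φ x) ^ 2) := by rw [← h2]; ring
    ring_nf
    simp only [h2, h3]
    ring
  have hvd : ∀ x, HasDerivAt v (- w x * u x) x := by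
    intro x
    have := (((hLd x).exp.mul (hs x)).mul (hφ x).cos)
    refine this.congr_deriv ?_
    have h1 := hne x
    have h2 : sin (φ x) ^ 2 = 1 - cos (φ x) ^ 2 := sin_sq _
    simp only [hρ, hu, Pi.mul_apply]
    field_simp
    have h3 : sin (φ x) ^ 3 = sin (φ x) * (1 - cos (φ x) ^ 2) := by rw [← h2]; ring
    ring_nf
    simp only [h2, h3]
    ring
  have hdu : deriv u = v := funext fun x => (hud x).deriv
  have hdv : deriv v = fun x => - w x * u x := funext fun x => (hvd x).deriv
  have huc : Continuous u := continuous_iff_continuousAt.2 fun x => (hud x).continuousAt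
  refine ⟨L, u, fun x => rfl, hLd, ?_, fun x => by rw [hdu], fun x => by rw [hdu, hdv], ?_⟩
  · rw [show (2 : WithTop ℕ∞) = 1 + 1 by norm_num, contDiff_succ_iff_deriv]
    refine ⟨fun x => (hud x).differentiableAt, by simp, ?_⟩
    rw [hdu, contDiff_one_iff_deriv]
    refine ⟨fun x => (hvd x).differentiableAt, ?_⟩
    rw [hdv]
    exact hw.neg.mul huc
  · by_contra! hcon
    have e : u =ᶠ[nhds 1] fun _ => 0 := by
      filter_upwards [Ioi_mem_nhds (show (0:ℝ) < 1 by norm_num)] with x hx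
      exact hcon x (mem_Ici.2 (le_of_lt hx))
    have h1 : deriv u 1 = 0 := by rw [e.deriv_eq]; simp
    have h2 := hcon 1 (by simp)
    rw [hdu] at h1
    simp only [hu, hv] at h1 h2
    have h4 := hne 1
    have h3 := exp_ne_zero (L 1)
    simp [h4] at h1 h2
    have := sin_sq_add_cos_sq (φ 1)
    simp [h1, h2] at this

lemma st_core (α : ℝ) (hα0 : 0 < α) {N : ℕ} (E θ : Fin N → ℝ) (s : Fin N → ℝ → ℝ) (g : ℝ → ℝ)
    (x0 : ℝ) (hx0 : 0 < x0) (hs : ∀ j, ContDiff ℝ (⊤ : ℕ∞) (s j)) (hpos : ∀ j x, 0 < s j x)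
    (hg : ContDiff ℝ (⊤ : ℕ∞) g) (hg0 : ∀ x ≤ x0, g x = 0) :
    ∃ (φ : Fin N → ℝ → ℝ) (q : ℝ → ℝ), (∀ x, q x = - g x * ∑ i, 2 * (sin (φ i x) * cos (φ i x))) ∧
      ContDiff ℝ (⊤ : ℕ∞) q ∧ ∀ j,
      (∀ x, HasDerivAt (φ j) (s j x ^ 2 * cos (φ j x) ^ 2
        + (x ^ α + E j - q x) / s j x ^ 2 * sin (φ j x) ^ 2
        + 2 * (deriv (s j) x / s j x) * (sin (φ j x) * cos (φ j x))) x) ∧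
      ∃ L u : ℝ → ℝ, (∀ x, u x = exp (L x) * sin (φ j x) / s j x) ∧
      (∀ x, HasDerivAt L (-(deriv (s j) x / s j x) * (cos (φ j x) ^ 2 - sin (φ j x) ^ 2)
        + (s j x ^ 2 - (x ^ α + E j - q x) / s j x ^ 2) * (sin (φ j x) * cos (φ j x))) x) ∧
      ContDiff ℝ 2 u ∧ 
      (∀ x, -(deriv (deriv u) x) - x ^ α * u x + q x * u x = E j * u x) ∧
      (∃ x ∈ Ici (0:ℝ), u x ≠ 0) ∧ deriv u 0 * cos (θ j) = u 0 * sin (θ j) := by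
  have hsc : ∀ j, Continuous (s j) := fun j => (hs j).continuous
  have hs'c : ∀ j, Continuous (deriv (s j)) := fun j => (hs j).continuous_deriv (by norm_num)
  have hne : ∀ j x, s j x ≠ 0 := fun j x => (hpos j x).ne'
  have hs's : ∀ j, ContDiff ℝ (⊤ : ℕ∞) (deriv (s j)) := fun j => (contDiff_infty_iff_deriv.1 (hs j)).2
  have hxα : Continuous fun x : ℝ => x ^ α := Real.continuous_rpow_const hα0.le
  let v : ℝ → (Fin N → ℝ) → (Fin N → ℝ) := fun t x j =>
    s j t ^ 2 * (cos (x j) * cos (x j)) + (1 / s j t ^ 2 * ((t ^ α + E j) +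
      g t * ∑ i, 2 * (sin (x i) * cos (x i)))) * (sin (x j) * sin (x j))
      + 2 * (deriv (s j) t / s j t) * (sin (x j) * cos (x j))
  have hv : ∀ j, StGood (fun t x => v t x j) := by
    intro j
    have c1 : Continuous fun t => s j t ^ 2 := (hsc j).pow 2
    have c2 : Continuous fun t => 1 / s j t ^ 2 :=
      continuous_const.div c1 (fun t => pow_ne_zero 2 (hne j t))
    have c3 : Continuous fun t => t ^ α + E j := hxα.add continuous_const
    have c4 : Continuous fun t => 2 * (deriv (s j) t / s j t) :=
      continuous_const.mul ((hs'c j).div (hsc j) (hne j))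
    refine StGood.add (StGood.add (StGood.mul (.of_cont c1) (.mul (.cos j) (.cos j))) (.mul (.mul (.of_cont c2)
      (.add (.of_cont c3) (.mul (.of_cont hg.continuous) (.sum _ fun i => .mul (.of_cont continuous_const)
      (.mul (.sin i) (.cos i)))))) (.mul (.sin j) (.sin j)))) (.mul (.of_cont c4) (.mul (.sin j) (.cos j)))
  let z : Fin N → ℂ := fun j => ⟨sin (θ j) / s j 0, s j 0 * cos (θ j)⟩
  obtain ⟨Φ, hΦ0, hΦ⟩ := st_global_ode v hv (fun j => (z j).arg)
  have hΦd : ∀ j x, HasDerivAt (fun t => Φ t j) (v x (Φ x) j) x := fun j x =>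
    (hasDerivAt_pi.1 (hΦ x)) j
  have hsm : ∀ n : ℕ, ContDiffOn ℝ n Φ (Ioi 0) := by
    intro n
    induction n with
    | zero =>
      simp only [Nat.cast_zero, contDiffOn_zero]
      exact fun x _ => (hΦ x).continuousAt.continuousWithinAt
    | succ n ih =>
      push_cast
      rw [contDiffOn_succ_iff_deriv_of_isOpen isOpen_Ioi]
      refine ⟨fun x _ => (hΦ x).differentiableAt.differentiableWithinAt, by simp, ?_⟩
      have e : deriv Φ = fun x => v x (Φ x) := funext fun x => (hΦ x).deriv
      rw [e, contDiffOn_pi]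
      have h1 : ∀ i, ContDiffOn ℝ n (fun x => Φ x i) (Ioi 0) := fun i => contDiffOn_pi.1 ih i
      have h2 : ∀ i, ContDiffOn ℝ n (fun x => sin (Φ x i)) (Ioi 0) := fun i => (h1 i).sin
      have h3 : ∀ i, ContDiffOn ℝ n (fun x => cos (Φ x i)) (Ioi 0) := fun i => (h1 i).cos
      intro j
      have hn : (n : WithTop ℕ∞) ≤ ((⊤ : ℕ∞) : WithTop ℕ∞) := by
        exact_mod_cast le_top
      have c1 : ContDiffOn ℝ n (s j) (Ioi 0) := ((hs j).of_le hn).contDiffOn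
      have c2 : ContDiffOn ℝ n (deriv (s j)) (Ioi 0) := ((hs's j).of_le hn).contDiffOn
      have c3 : ContDiffOn ℝ n g (Ioi 0) := (hg.of_le hn).contDiffOn
      have c4 : ContDiffOn ℝ n (fun x : ℝ => x ^ α) (Ioi 0) := by
        refine ContDiffOn.rpow_const_of_ne contDiffOn_id fun x hx => (ne_of_gt hx)
      have c5 : ContDiffOn ℝ n (fun x => 1 / s j x ^ 2) (Ioi 0) :=
        contDiffOn_const.div (c1.pow 2) (fun t _ => pow_ne_zero 2 (hne j t))
      have c6 : ContDiffOn ℝ n (fun x => deriv (s j) x / s j x) (Ioi 0) :=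
        c2.div c1 (fun t _ => hne j t)
      exact (((c1.pow 2).mul ((h3 j).mul (h3 j))).add ((c5.mul ((c4.add contDiffOn_const).add 
        (c3.mul (ContDiffOn.sum fun i _ => contDiffOn_const.mul ((h2 i).mul (h3 i)))))).mul
        ((h2 j).mul (h2 j)))).add ((contDiffOn_const.mul c6).mul ((h2 j).mul (h3 j)))
  let q : ℝ → ℝ := fun x => - g x * ∑ i, 2 * (sin (Φ x i) * cos (Φ x i))
  have hq : ContDiff ℝ (⊤ : ℕ∞) q := by
    rw [contDiff_iff_contDiffAt]
    intro x
    rcases lt_or_ge x x0 with h | h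
    · refine (contDiffAt_const (c := (0:ℝ))).congr_of_eventuallyEq ?_
      filter_upwards [Iio_mem_nhds h] with y hy
      simp [q, hg0 y (le_of_lt hy)]
    · have hx : 0 < x := hx0.trans_le h
      have hΦs : ContDiffOn ℝ (⊤ : ℕ∞) Φ (Ioi 0) := contDiffOn_infty.2 hsm
      have hΦa : ContDiffAt ℝ (⊤ : ℕ∞) Φ x := hΦs.contDiffAt (Ioi_mem_nhds hx)
      have h1 : ∀ i, ContDiffAt ℝ (⊤ : ℕ∞) (fun x => Φ x i) x := fun i => contDiffAt_pi.1 hΦa i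
      exact hg.contDiffAt.neg.mul (ContDiffAt.sum fun i _ => contDiffAt_const.mul ((h1 i).sin.mul (h1 i).cos))
  refine ⟨fun j t => Φ t j, q, fun x => rfl, hq, fun j => ?_⟩
  have hd : ∀ x, HasDerivAt (fun t => Φ t j) (s j x ^ 2 * cos (Φ x j) ^ 2
        + (x ^ α + E j - q x) / s j x ^ 2 * sin (Φ x j) ^ 2
        + 2 * (deriv (s j) x / s j x) * (sin (Φ x j) * cos (Φ x j))) x := by
    intro x
    refine (hΦd j x).congr_deriv ?_
    simp only [v, q]
    ring
  refine ⟨hd, ?_⟩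
  obtain ⟨L, u, hu, hL, hu2, hu', hu'', hnz⟩ := st_prufer (s j) (deriv (s j)) (fun t => Φ t j)
    (fun x => x ^ α + E j - q x) (fun x => ((hs j).differentiable (by norm_num) x).hasDerivAt)
    (hs'c j) (hpos j) ((hxα.add continuous_const).sub hq.continuous) hd
  refine ⟨L, u, hu, hL, hu2, fun x => ?_, hnz, ?_⟩
  · rw [hu'']; ring
  · rw [hu', hu, hΦ0]
    have h0 := hne j 0
    have hz : z j ≠ 0 := by
      intro h
      have h1 := congrArg Complex.re h
      have h2 := congrArg Complex.im h
      simp [z, h0] at h1 h2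
      have := sin_sq_add_cos_sq (θ j)
      simp [h1, h2] at this
    simp only [Complex.cos_arg hz, Complex.sin_arg]
    have : ‖z j‖ ≠ 0 := norm_ne_zero_iff.2 hz
    simp only [z] at this ⊢
    field_simp


def StSym (m : ℝ) (f : ℝ → ℝ) : Prop :=
  ∃ (f' : ℝ → ℝ) (C : ℝ), 0 ≤ C ∧ ∀ᶠ x in atTop, HasDerivAt f (f' x) x ∧ |f x| ≤ C * x ^ m ∧
    |f' x| ≤ C * x ^ (m - 1)

lemma StSym.mul {m n : ℝ} {f g : ℝ → ℝ} (hf : StSym m f) (hg : StSym n g) :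
    StSym (m + n) (fun x => f x * g x) := by
  obtain ⟨f', C, hC, hf⟩ := hf
  obtain ⟨g', D, hD, hg⟩ := hg
  refine ⟨fun x => f' x * g x + f x * g' x, C * D + C * D, by positivity, ?_⟩
  filter_upwards [hf, hg, eventually_gt_atTop 0] with x ⟨h1, h2, h3⟩ ⟨k1, k2, k3⟩ hx
  have hCD : 0 ≤ C * D := mul_nonneg hC hD
  refine ⟨h1.mul k1, ?_, ?_⟩
  · rw [abs_mul]
    have := mul_le_mul h2 k2 (abs_nonneg _) (by positivity)
    have e : C * x ^ m * (D * x ^ n) = C * D * x ^ (m + n) := by rw [rpow_add hx]; ring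
    rw [e] at this
    have : 0 ≤ C * D * x ^ (m + n) := by positivity
    linarith
  · refine (abs_add_le _ _).trans ?_
    rw [abs_mul, abs_mul]
    have t1 := mul_le_mul h3 k2 (abs_nonneg _) (by positivity)
    have t2 := mul_le_mul h2 k3 (abs_nonneg _) (by positivity)
    have e1 : C * x ^ (m - 1) * (D * x ^ n) = C * D * x ^ (m + n - 1) := by
      rw [show m + n - 1 = (m - 1) + n by ring, rpow_add hx]; ring
    have e2 : C * x ^ m * (D * x ^ (n - 1)) = C * D * x ^ (m + n - 1) := by
      rw [show m + n - 1 = m + (n - 1) by ring, rpow_add hx]; ring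
    rw [e1] at t1
    rw [e2] at t2
    linarith

lemma StSym.add {m : ℝ} {f g : ℝ → ℝ} (hf : StSym m f) (hg : StSym m g) :
    StSym m (fun x => f x + g x) := by
  obtain ⟨f', C, hC, hf⟩ := hf
  obtain ⟨g', D, hD, hg⟩ := hg
  refine ⟨fun x => f' x + g' x, C + D, by positivity, ?_⟩
  filter_upwards [hf, hg] with x ⟨h1, h2, h3⟩ ⟨k1, k2, k3⟩
  refine ⟨h1.add k1, ?_, ?_⟩
  · rw [add_mul]; exact (abs_add_le _ _).trans (add_le_add h2 k2)
  · rw [add_mul]; exact (abs_add_le _ _).trans (add_le_add h3 k3)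

lemma StSym.mono {m n : ℝ} {f : ℝ → ℝ} (hf : StSym m f) (h : m ≤ n) : StSym n f := by
  obtain ⟨f', C, hC, hf⟩ := hf
  refine ⟨f', C, hC, ?_⟩
  filter_upwards [hf, eventually_ge_atTop 1] with x ⟨h1, h2, h3⟩ hx
  refine ⟨h1, h2.trans ?_, h3.trans ?_⟩
  · gcongr
  · gcongr

lemma StSym.const (c : ℝ) : StSym 0 (fun _ => c) := by
  refine ⟨fun _ => 0, |c|, abs_nonneg _, ?_⟩
  filter_upwards [eventually_gt_atTop 0] with x hx
  refine ⟨hasDerivAt_const _ _, by simp, ?_⟩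
  simp; positivity

lemma StSym.const_mul {m : ℝ} {f : ℝ → ℝ} (c : ℝ) (hf : StSym m f) : StSym m (fun x => c * f x) := by
  have := (StSym.const c).mul hf
  rwa [zero_add] at this

lemma StSym.congr {m : ℝ} {f g : ℝ → ℝ} (hf : StSym m f) (h : ∀ᶠ x in atTop, g x = f x) :
    StSym m g := by
  obtain ⟨f', C, hC, hf⟩ := hf
  obtain ⟨X, hX⟩ := eventually_atTop.1 h
  refine ⟨f', C, hC, ?_⟩
  filter_upwards [hf, eventually_gt_atTop X] with x ⟨h1, h2, h3⟩ hx
  refine ⟨h1.congr_of_eventuallyEq ?_, by rwa [hX x hx.le], h3⟩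
  filter_upwards [Ioi_mem_nhds hx] with y hy
  exact hX y (le_of_lt hy)

lemma StSym.rpow (m : ℝ) : StSym m (fun x => x ^ m) := by
  refine ⟨fun x => m * x ^ (m - 1), 1 + |m|, by positivity, ?_⟩
  filter_upwards [eventually_gt_atTop 0] with x hx
  have h1 : 0 < x ^ m := by positivity
  have h2 : 0 < x ^ (m - 1) := by positivity
  refine ⟨hasDerivAt_rpow_const (Or.inl hx.ne'), ?_, ?_⟩
  · rw [abs_of_pos h1]; nlinarith [abs_nonneg m]
  · rw [abs_mul, abs_of_pos h2]; nlinarith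

lemma StSym.inv {m c : ℝ} {f : ℝ → ℝ} (hf : StSym m f) (hc : 0 < c)
    (h : ∀ᶠ x in atTop, c * x ^ m ≤ f x) : StSym (-m) (fun x => (f x)⁻¹) := by
  obtain ⟨f', C, hC, hf⟩ := hf
  refine ⟨fun x => -f' x / f x ^ 2, c⁻¹ + C * (c⁻¹) ^ 2, by positivity, ?_⟩
  filter_upwards [hf, h, eventually_gt_atTop 0] with x ⟨h1, h2, h3⟩ hl hx
  have hp : 0 < x ^ m := by positivity
  have hcp : 0 < c * x ^ m := by positivity
  have hfp : 0 < f x := hcp.trans_le hl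
  have hinv : (f x)⁻¹ ≤ c⁻¹ * x ^ (-m) := by
    rw [rpow_neg hx.le, ← mul_inv]
    exact inv_anti₀ hcp hl
  refine ⟨h1.inv hfp.ne', ?_, ?_⟩
  · rw [abs_of_pos (inv_pos.2 hfp)]
    have : 0 ≤ C * c⁻¹ ^ 2 * x ^ (-m) := by positivity
    nlinarith
  · rw [abs_div, abs_neg, abs_of_pos (pow_pos hfp 2), div_eq_mul_inv, ← inv_pow]
    have t : ((f x)⁻¹) ^ 2 ≤ (c⁻¹ * x ^ (-m)) ^ 2 := by
      gcongr
    have t2 := mul_le_mul h3 t (by positivity) (by positivity)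
    have e : C * x ^ (m - 1) * (c⁻¹ * x ^ (-m)) ^ 2 = C * c⁻¹ ^ 2 * x ^ (-m - 1) := by
      rw [show -m - 1 = (m - 1) + (-m) + (-m) by ring, rpow_add hx, rpow_add hx]; ring
    rw [e] at t2
    have : 0 ≤ c⁻¹ * x ^ (-m - 1) := by positivity
    nlinarith

lemma StSym.comp_rpow {m c r : ℝ} {f : ℝ → ℝ} (hf : StSym m f) (hc : 0 < c) (hr : 0 ≤ r)
    (h : ∀ᶠ x in atTop, c * x ^ m ≤ f x) : StSym (m * r) (fun x => (f x) ^ r) := by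
  obtain ⟨f', C, hC, hf⟩ := hf
  refine ⟨fun x => f' x * r * f x ^ (r - 1), C ^ r + C * r * C ^ r * c⁻¹, by positivity, ?_⟩
  filter_upwards [hf, h, eventually_gt_atTop 0] with x ⟨h1, h2, h3⟩ hl hx
  have hp : 0 < x ^ m := by positivity
  have hcp : 0 < c * x ^ m := by positivity
  have hfp : 0 < f x := hcp.trans_le hl
  rw [abs_of_pos hfp] at h2
  have hinv : (f x)⁻¹ ≤ c⁻¹ * x ^ (-m) := by
    rw [rpow_neg hx.le, ← mul_inv]
    exact inv_anti₀ hcp hl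
  have hfr : f x ^ r ≤ C ^ r * x ^ (m * r) := by
    rw [rpow_mul hx.le, ← mul_rpow hC hp.le]
    exact rpow_le_rpow hfp.le h2 hr
  refine ⟨h1.rpow_const (Or.inl hfp.ne'), ?_, ?_⟩
  · rw [abs_of_pos (rpow_pos_of_pos hfp r)]
    have : 0 ≤ C * r * C ^ r * c⁻¹ * x ^ (m * r) := by positivity
    nlinarith
  · rw [abs_mul, abs_mul, abs_of_nonneg hr, abs_of_pos (rpow_pos_of_pos hfp _), rpow_sub_one hfp.ne',
      div_eq_mul_inv]
    have t1 := mul_le_mul hfr hinv (by positivity) (by positivity)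
    have t2 := mul_le_mul (mul_le_mul_of_nonneg_right h3 hr) t1 (by positivity) (by positivity)
    have e : C * x ^ (m - 1) * r * (C ^ r * x ^ (m * r) * (c⁻¹ * x ^ (-m))) =
        C * r * C ^ r * c⁻¹ * x ^ (m * r - 1) := by
      rw [show m * r - 1 = (m - 1) + m * r + (-m) by ring, rpow_add hx, rpow_add hx]; ring
    rw [e] at t2
    have : 0 ≤ C ^ r * x ^ (m * r - 1) := by positivity
    nlinarith

lemma StSym.inv_log : StSym 0 (fun x => (log x)⁻¹) := by
  refine ⟨fun x => - x⁻¹ / (log x) ^ 2, 1, zero_le_one, ?_⟩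
  filter_upwards [tendsto_log_atTop.eventually_ge_atTop 1, eventually_gt_atTop 0] with x hl hx
  have h0 : 0 < log x := by linarith
  refine ⟨(hasDerivAt_log hx.ne').inv h0.ne', ?_, ?_⟩
  · rw [abs_of_pos (inv_pos.2 h0)]; simp; exact inv_le_one_of_one_le₀ hl
  · rw [abs_div, abs_neg, abs_of_pos (inv_pos.2 hx), abs_of_pos (pow_pos h0 2)]
    simp only [zero_sub, rpow_neg_one, one_mul]
    exact div_le_self (by positivity) (one_le_pow₀ hl)

def StOsc (δ : ℝ) (F : ℝ → ℝ) : Prop :=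
  ∃ (B B' : ℝ → ℝ) (C : ℝ), 0 ≤ C ∧ ∀ᶠ x in atTop, HasDerivAt B (B' x) x ∧ |B x| ≤ C ∧
    |B' x - F x| ≤ C * x ^ (-1 - δ)

lemma StOsc.add {δ : ℝ} {F G : ℝ → ℝ} (hF : StOsc δ F) (hG : StOsc δ G) :
    StOsc δ (fun x => F x + G x) := by
  obtain ⟨B, B', C, hC, h⟩ := hF
  obtain ⟨A, A', D, hD, k⟩ := hG
  refine ⟨fun x => B x + A x, fun x => B' x + A' x, C + D, by positivity, ?_⟩
  filter_upwards [h, k] with x ⟨h1, h2, h3⟩ ⟨k1, k2, k3⟩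
  refine ⟨h1.add k1, (abs_add_le _ _).trans (add_le_add h2 k2), ?_⟩
  rw [add_sub_add_comm, add_mul]
  exact (abs_add_le _ _).trans (add_le_add h3 k3)

lemma StOsc.zero (δ : ℝ) : StOsc δ (fun _ => 0) := by
  refine ⟨fun _ => 0, fun _ => 0, 0, le_rfl, ?_⟩
  filter_upwards with x
  exact ⟨hasDerivAt_const _ _, by simp, by simp⟩

lemma StOsc.sum {δ : ℝ} {ι : Type*} (s : Finset ι) {F : ι → ℝ → ℝ}
    (hF : ∀ i, StOsc δ (F i)) : StOsc δ (fun x => ∑ i ∈ s, F i x) := by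
  classical
  induction s using Finset.induction_on with
  | empty => simpa using StOsc.zero δ
  | insert a s ha ih =>
    simp only [Finset.sum_insert ha]
    exact (hF a).add ih

lemma StOsc.congr {δ : ℝ} {F G : ℝ → ℝ} (hF : StOsc δ F) (h : ∀ᶠ x in atTop, G x = F x) :
    StOsc δ G := by
  obtain ⟨B, B', C, hC, k⟩ := hF
  refine ⟨B, B', C, hC, ?_⟩
  filter_upwards [h, k] with x h k
  rwa [h]

lemma st_osc_cos {δ C : ℝ} (hδ : 0 ≤ δ) {A ψ ω e : ℝ → ℝ} (hA : StSym (-δ) A)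
    (hψ : ∀ᶠ x in atTop, HasDerivAt ψ (ω x + e x) x) 
    (he : ∀ᶠ x in atTop, |e x| ≤ C * x⁻¹) : StOsc δ (fun x => A x * ω x * cos (ψ x)) := by
  obtain ⟨A', D, hD, hA⟩ := hA
  refine ⟨fun x => A x * sin (ψ x), fun x => A' x * sin (ψ x) + A x * (cos (ψ x) * (ω x + e x)),
    D + D * |C|, by positivity, ?_⟩
  filter_upwards [hA, hψ, he, eventually_ge_atTop 1] with x ⟨h1, h2, h3⟩ k he hx
  have hx0 : 0 < x := by linarith
  refine ⟨h1.mul k.sin, ?_, ?_⟩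
  · rw [abs_mul]
    have t := mul_le_mul h2 (abs_sin_le_one (ψ x)) (abs_nonneg _) (by positivity)
    have : x ^ (-δ) ≤ 1 := rpow_le_one_of_one_le_of_nonpos hx (by linarith)
    have t2 := mul_le_mul_of_nonneg_left this hD
    have : 0 ≤ D * |C| := by positivity
    linarith
  · have e1 : A' x * sin (ψ x) + A x * (Real.cos (ψ x) * (ω x + e x)) - A x * ω x * Real.cos (ψ x)
      = A' x * sin (ψ x) + A x * e x * Real.cos (ψ x) := by ring
    rw [e1]
    refine (abs_add_le _ _).trans ?_
    rw [abs_mul, abs_mul, abs_mul]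
    have t1 := mul_le_mul h3 (abs_sin_le_one (ψ x)) (abs_nonneg _) (by positivity)
    have he' : |e x| ≤ |C| * x⁻¹ := he.trans (by gcongr; exact le_abs_self C)
    have t2 := mul_le_mul (mul_le_mul h2 he' (abs_nonneg _) (by positivity)) (abs_cos_le_one (ψ x))
      (abs_nonneg _) (by positivity)
    have e2 : x ^ (-δ - 1) = x ^ (-δ) * x⁻¹ := by rw [rpow_sub_one hx0.ne', div_eq_mul_inv]
    rw [show -1 - δ = -δ - 1 by ring]
    rw [e2] at t1 ⊢
    linarith

lemma st_upper {α δ : ℝ} (hδ : 0 < δ) {L L' F G : ℝ → ℝ} (hL : ∀ᶠ x in atTop, HasDerivAt L (L' x) x)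
    (hF : StOsc δ F) (hLe : ∀ᶠ x in atTop, L' x = - G x + F x)
    (hG : ∀ᶠ x in atTop, ((2 - α) + 4 / log x) / (4 * x) ≤ G x) :
    ∃ C, ∀ᶠ x in atTop, L x ≤ C - (2 - α) / 4 * log x - log (log x) := by
  obtain ⟨B, B', C, hC, hB⟩ := hF
  have hall := (((((hL.and hB).and hLe).and hG).and (eventually_gt_atTop 0)).and
    (tendsto_log_atTop.eventually_gt_atTop 0))
  obtain ⟨X, hX⟩ := eventually_atTop.1 hall
  set D : ℝ → ℝ := fun x => L x - B x + (2 - α) / 4 * log x + log (log x) + C / δ * x ^ (-δ) with hD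
  have hder : ∀ x, X ≤ x → HasDerivAt D (L' x - B' x + (2 - α) / 4 * x⁻¹ + x⁻¹ / log x
      + C / δ * (-δ * x ^ (-δ - 1))) x := by
    intro x hx
    obtain ⟨⟨⟨⟨⟨h1, h2, h3, h4⟩, h5⟩, h6⟩, h7⟩, h8⟩ := hX x hx
    exact ((((h1.sub h2).add ((hasDerivAt_log h7.ne').const_mul _)).add
      ((hasDerivAt_log h7.ne').log h8.ne')).add
      ((hasDerivAt_rpow_const (Or.inl h7.ne')).const_mul _))
  have anti : AntitoneOn D (Ici X) := by
    refine antitoneOn_of_deriv_nonpos (convex_Ici X)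
      (fun x hx => (hder x hx).continuousAt.continuousWithinAt) ?_ ?_
    · intro x hx
      rw [interior_Ici] at hx
      exact (hder x (le_of_lt hx)).differentiableAt.differentiableWithinAt
    · intro x hx
      rw [interior_Ici] at hx
      rw [(hder x (le_of_lt hx)).deriv]
      obtain ⟨⟨⟨⟨⟨h1, h2, h3, h4⟩, h5⟩, h6⟩, h7⟩, h8⟩ := hX x (le_of_lt hx)
      have h9 := (abs_le.1 h4).1
      rw [h5]
      have e : C / δ * (-δ * x ^ (-δ - 1)) = - (C * x ^ (-1 - δ)) := by
        rw [show -1 - δ = -δ - 1 by ring]; field_simp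
      have e2 : ((2 - α) + 4 / log x) / (4 * x) = (2 - α) / 4 * x⁻¹ + x⁻¹ / log x := by
        field_simp
      rw [e]; rw [e2] at h6
      linarith
  refine ⟨D X + C, ?_⟩
  filter_upwards [eventually_ge_atTop X] with x hx
  have h := anti (mem_Ici.2 le_rfl) (mem_Ici.2 hx) hx
  obtain ⟨⟨⟨⟨⟨h1, h2, h3, h4⟩, h5⟩, h6⟩, h7⟩, h8⟩ := hX x hx
  have hp : 0 ≤ C / δ * x ^ (-δ) := by positivity
  have := (abs_le.1 h3).2
  simp only [hD] at h ⊢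
  linarith


lemma st_decay {α : ℝ} (hα0 : 0 < α) (hα2 : α < 2) {N : ℕ} {E : Fin N → ℝ}
    (hE : Function.Injective E) {p φ : Fin N → ℝ → ℝ} {k g L L' : ℝ → ℝ} {c : ℝ} (hc : 0 < c)
    (hp : ∀ i, StSym (α / 2) (p i)) (hpl : ∀ i, ∀ᶠ x in atTop, c * x ^ (α / 2) ≤ p i x)
    (hk : StSym (-1) k) (hg : StSym (α / 2 - 1) g)
    (hpp : ∀ i l, ∀ᶠ x in atTop, p i x ^ 2 - p l x ^ 2 = E i - E l)
    {e : Fin N → ℝ → ℝ} {C : ℝ}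
    (hφ : ∀ i, ∀ᶠ x in atTop, HasDerivAt (φ i) (p i x + e i x) x)
    (he : ∀ i, ∀ᶠ x in atTop, |e i x| ≤ C * x⁻¹) (j : Fin N)
    (hL : ∀ᶠ x in atTop, HasDerivAt L (L' x) x)
    (hL' : ∀ᶠ x in atTop, L' x = - k x * cos (2 * φ j x)
      - g x / (2 * p j x) * ((∑ i, sin (2 * φ i x)) * sin (2 * φ j x)))
    (hG : ∀ᶠ x in atTop, ((2 - α) + 4 / log x) / (4 * x) ≤ g x / (4 * p j x)) :
    ∃ C, ∀ᶠ x in atTop, L x ≤ C - (2 - α) / 4 * log x - log (log x) := by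
  have hpos : ∀ i, ∀ᶠ x in atTop, 0 < p i x := by
    intro i
    filter_upwards [hpl i, eventually_gt_atTop 0] with x h hx
    exact lt_of_lt_of_le (by positivity) h
  have hpi : StSym (-(α / 2)) (fun x => (p j x)⁻¹) := (hp j).inv hc (hpl j)
  have hδ : (0:ℝ) < 1 - α / 2 := by linarith
  have hpsi : ∀ i, StSym (-(α / 2)) (fun x => (p i x + p j x)⁻¹) := by
    intro i
    refine ((hp i).add (hp j)).inv hc ?_
    filter_upwards [hpl i, hpos j] with x h1 h2
    linarith
  have T0 : StOsc (1 - α / 2) (fun x => - k x * cos (2 * φ j x)) := by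
    have hA : StSym (-(1 - α / 2)) (fun x => (-1 / 2) * (k x * (p j x)⁻¹)) :=
      (StSym.const_mul _ (hk.mul hpi)).mono (by linarith)
    have := st_osc_cos (ψ := fun x => 2 * φ j x) (ω := fun x => 2 * p j x) (e := fun x => 2 * e j x)
      (C := 2 * C) hδ.le hA ?_ ?_
    · refine this.congr ?_
      filter_upwards [hpos j] with x h
      field_simp
    · filter_upwards [hφ j] with x h
      exact (h.const_mul 2).congr_deriv (by ring)
    · filter_upwards [he j] with x h
      rw [abs_mul, abs_two]; linarith
  have Tp : ∀ i, StOsc (1 - α / 2) (fun x => g x / (4 * p j x) * cos (2 * φ i x + 2 * φ j x)) := by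
    intro i
    have hA : StSym (-(1 - α / 2)) (fun x => (1 / 8) * (g x * (p j x)⁻¹ * (p i x + p j x)⁻¹)) :=
      (StSym.const_mul _ ((hg.mul hpi).mul (hpsi i))).mono (by linarith)
    have := st_osc_cos (ψ := fun x => 2 * φ i x + 2 * φ j x) (ω := fun x => 2 * p i x + 2 * p j x)
      (e := fun x => 2 * e i x + 2 * e j x) (C := 4 * C) hδ.le hA ?_ ?_
    · refine this.congr ?_
      filter_upwards [hpos i, hpos j] with x h h'
      have : p i x + p j x ≠ 0 := by positivity
      field_simp
      ring
    · filter_upwards [hφ i, hφ j] with x h h'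
      exact ((h.const_mul 2).add (h'.const_mul 2)).congr_deriv (by ring)
    · filter_upwards [he i, he j] with x h h'
      refine (abs_add_le _ _).trans ?_
      rw [abs_mul, abs_mul, abs_two]; linarith
  have Tm : ∀ i, i ≠ j → StOsc (1 - α / 2)
      (fun x => - (g x / (4 * p j x)) * cos (2 * φ i x - 2 * φ j x)) := by
    intro i hij
    have hEd : E i - E j ≠ 0 := sub_ne_zero.2 (fun h => hij (hE h))
    have hA : StSym (-(1 - α / 2)) (fun x => (-1 / (8 * (E i - E j))) *
        (g x * (p j x)⁻¹ * (p i x + p j x))) :=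
      (StSym.const_mul _ ((hg.mul hpi).mul ((hp i).add (hp j)))).mono (by linarith)
    have := st_osc_cos (ψ := fun x => 2 * φ i x - 2 * φ j x) (ω := fun x => 2 * p i x - 2 * p j x)
      (e := fun x => 2 * e i x - 2 * e j x) (C := 4 * C) hδ.le hA ?_ ?_
    · refine this.congr ?_
      filter_upwards [hpos i, hpos j, hpp i j] with x h h' h''
      have : (-1 / (8 * (E i - E j))) * (g x * (p j x)⁻¹ * (p i x + p j x)) * (2 * p i x - 2 * p j x)
        = - (g x / (4 * p j x)) * ((p i x ^ 2 - p j x ^ 2) / (E i - E j)) := by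
        field_simp; ring
      rw [this, h'', div_self hEd, mul_one]
    · filter_upwards [hφ i, hφ j] with x h h'
      exact ((h.const_mul 2).sub (h'.const_mul 2)).congr_deriv (by ring)
    · filter_upwards [he i, he j] with x h h'
      refine (abs_sub _ _).trans ?_
      rw [abs_mul, abs_mul, abs_two]; linarith
  have Ti : ∀ i, StOsc (1 - α / 2) (fun x => - (g x / (2 * p j x) * (sin (2 * φ i x) * sin (2 * φ j x)))
      + if i = j then g x / (4 * p j x) else 0) := by
    intro i
    by_cases hij : i = j
    · subst hij
      refine (Tp i).congr ?_
      filter_upwards [hpos i] with x h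
      simp only [if_true]
      rw [cos_add, ← sq, ← sq, cos_sq']
      field_simp
      ring
    · refine ((Tp i).add (Tm i hij)).congr ?_
      filter_upwards [hpos j] with x h
      simp only [if_neg hij]
      rw [cos_add, cos_sub]
      field_simp
      ring
  refine st_upper hδ hL (T0.add (StOsc.sum Finset.univ Ti)) ?_ hG
  filter_upwards [hL'] with x h
  rw [h, Finset.sum_add_distrib]
  simp only [Finset.sum_ite_eq', Finset.mem_univ, if_true, Finset.sum_neg_distrib, ← Finset.mul_sum,
    ← Finset.sum_mul]
  ring

lemma st_integrable {α C c : ℝ} (hc : 0 < c) {u L φ s : ℝ → ℝ} (hu : Continuous u)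
    (h : ∀ x, u x = exp (L x) * sin (φ x) / s x)
    (hs : ∀ᶠ x in atTop, c * x ^ (α / 2) ≤ s x ^ 2)
    (hL : ∀ᶠ x in atTop, L x ≤ C - (2 - α) / 4 * log x - log (log x)) :
    IntegrableOn (fun x => u x ^ 2) (Ioi 0) := by
  obtain ⟨X, hX⟩ := eventually_atTop.1 (hs.and hL)
  set Y := max X 2 with hY
  have hY0 : (0:ℝ) ≤ Y := le_trans (by norm_num) (le_max_right X 2)
  rw [← Ioc_union_Ioi_eq_Ioi hY0]
  refine IntegrableOn.union ?_ ?_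
  · exact ((hu.pow 2).integrableOn_Icc (a := 0) (b := Y)).mono_set Ioc_subset_Icc_self
  · have hdom := (integrableOn_inv_div_log_sq_Ioi (c := Y)
      (lt_of_lt_of_le (by norm_num) (le_max_right X 2))).const_mul (exp (2 * C) / c)
    refine Integrable.mono' hdom (hu.pow 2).aestronglyMeasurable ?_
    refine (ae_restrict_iff' measurableSet_Ioi).2 (Eventually.of_forall fun x hx => ?_)
    have hxX : X ≤ x := (le_max_left X 2).trans (le_of_lt hx)
    have hx2 : (2:ℝ) < x := lt_of_le_of_lt (le_max_right X 2) hx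
    have hx0 : 0 < x := by linarith
    have hl : 0 < log x := log_pos (by linarith)
    obtain ⟨h1, h2⟩ := hX x hxX
    rw [Real.norm_eq_abs, abs_of_nonneg (sq_nonneg _), h, div_pow, mul_pow]
    have hcx : 0 < c * x ^ (α / 2) := by positivity
    have e1 : exp (L x) ^ 2 * sin (φ x) ^ 2 ≤ exp (2 * (C - (2 - α) / 4 * log x - log (log x))) := by
      rw [← exp_nat_mul]
      have : sin (φ x) ^ 2 ≤ 1 := sin_sq_le_one _
      have t : exp ((2:ℕ) * L x) ≤ exp (2 * (C - (2 - α) / 4 * log x - log (log x))) := by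
        apply exp_le_exp.2; push_cast; linarith
      calc _ ≤ exp ((2:ℕ) * L x) * 1 := by gcongr
        _ ≤ _ := by rw [mul_one]; exact t
    have e2 : exp (2 * (C - (2 - α) / 4 * log x - log (log x))) / (c * x ^ (α / 2)) =
        exp (2 * C) / c * (x⁻¹ / log x ^ 2) := by
      have a1 : 2 * (C - (2 - α) / 4 * log x - log (log x)) = 2 * C + log x * (α / 2) - log x
        - (log (log x) + log (log x)) := by ring
      rw [a1, exp_sub, exp_sub, exp_add, exp_add, exp_log hl, ← rpow_def_of_pos hx0, exp_log hx0]
      have : x ^ (α / 2) ≠ 0 := by positivity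
      field_simp
    rw [← e2]
    exact div_le_div₀ (exp_pos _).le e1 hcx h1


noncomputable def starkM (x0 x : ℝ) : ℝ := x0 + Real.smoothTransition (x - x0) * (x - x0)

lemma stM_contDiff (x0 : ℝ) : ContDiff ℝ (⊤ : ℕ∞) (starkM x0) := by
  unfold starkM
  have h : ContDiff ℝ (⊤ : ℕ∞) (fun x : ℝ => x - x0) := contDiff_id.sub contDiff_const
  exact contDiff_const.add ((Real.smoothTransition.contDiff.comp h).mul h)

lemma stM_ge (x0 x : ℝ) : x0 ≤ starkM x0 x := by
  unfold starkM
  rcases le_total x x0 with h | h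
  · rw [Real.smoothTransition.zero_of_nonpos (by linarith)]; simp
  · have := mul_nonneg (Real.smoothTransition.nonneg (x - x0)) (sub_nonneg.2 h)
    linarith

lemma stM_eq {x0 x : ℝ} (h : x0 + 1 ≤ x) : starkM x0 x = x := by
  unfold starkM
  rw [Real.smoothTransition.one_of_one_le (by linarith)]; ring

noncomputable def stS (α x0 e x : ℝ) : ℝ := (starkM x0 x ^ α + e) ^ (1 / 4 : ℝ)

noncomputable def stG (α x0 M x : ℝ) : ℝ :=
  Real.smoothTransition (x - x0) * (((2 - α) + 4 / log (starkM x0 x)) *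
    ((starkM x0 x ^ α + M) ^ (1 / 2 : ℝ) / starkM x0 x))

lemma st_base_ge {α x0 e M : ℝ} (hα : 0 < α) (hx0 : 2 ≤ x0) (hM : M + 1 ≤ x0 ^ α) (he : -M ≤ e)
    (x : ℝ) : 1 ≤ starkM x0 x ^ α + e := by
  have := rpow_le_rpow (by linarith) (stM_ge x0 x) hα.le
  linarith

lemma stBase_contDiff {α x0 : ℝ} (e : ℝ) (hx0 : 2 ≤ x0) :
    ContDiff ℝ (⊤ : ℕ∞) (fun x => starkM x0 x ^ α + e) := by
  refine ContDiff.add ?_ contDiff_const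
  exact (stM_contDiff x0).rpow_const_of_ne fun x => by linarith [stM_ge x0 x]

lemma stS_contDiff {α x0 e M : ℝ} (hα : 0 < α) (hx0 : 2 ≤ x0) (hM : M + 1 ≤ x0 ^ α) (he : -M ≤ e) :
    ContDiff ℝ (⊤ : ℕ∞) (stS α x0 e) := by
  exact (stBase_contDiff e hx0).rpow_const_of_ne fun x => by
    linarith [st_base_ge hα hx0 hM he x]

lemma stG_contDiff {α x0 M : ℝ} (hα : 0 < α) (hx0 : 2 ≤ x0) (hM : M + 1 ≤ x0 ^ α) (hM0 : 0 ≤ M) :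
    ContDiff ℝ (⊤ : ℕ∞) (stG α x0 M) := by
  have h : ContDiff ℝ (⊤ : ℕ∞) (fun x : ℝ => x - x0) := contDiff_id.sub contDiff_const
  have hne : ∀ x, starkM x0 x ≠ 0 := fun x => by linarith [stM_ge x0 x]
  refine (Real.smoothTransition.contDiff.comp h).mul ((contDiff_const.add 
    (contDiff_const.div ((stM_contDiff x0).log hne) ?_)).mul (ContDiff.div ?_ (stM_contDiff x0) hne))
  · intro x
    exact (log_pos (by linarith [stM_ge x0 x])).ne'
  · exact (stBase_contDiff M hx0).rpow_const_of_ne fun x => by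
      linarith [st_base_ge hα hx0 hM (show -M ≤ M by linarith) x]

lemma st_sym_base {α : ℝ} (hα : 0 < α) (e : ℝ) : StSym α (fun x => x ^ α + e) :=
  (StSym.rpow α).add ((StSym.const e).mono hα.le)

lemma st_base_lower {α : ℝ} (hα : 0 < α) (e : ℝ) :
    ∀ᶠ x : ℝ in atTop, 1 / 2 * x ^ α ≤ x ^ α + e := by
  filter_upwards [(tendsto_rpow_atTop hα).eventually_ge_atTop (-2 * e)] with x hx
  linarith

lemma st_sym_sqrt {α : ℝ} (hα : 0 < α) (e : ℝ) :
    StSym (α / 2) (fun x => (x ^ α + e) ^ (1 / 2 : ℝ)) := by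
  have := (st_sym_base hα e).comp_rpow (c := 1 / 2) (r := 1 / 2) (by norm_num) (by norm_num)
    (st_base_lower hα e)
  rwa [show α * (1 / 2) = α / 2 by ring] at this

lemma st_sqrt_lower {α : ℝ} (hα : 0 < α) (e : ℝ) :
    ∀ᶠ x : ℝ in atTop, (1 / 2 : ℝ) ^ (1 / 2 : ℝ) * x ^ (α / 2) ≤ (x ^ α + e) ^ (1 / 2 : ℝ) := by
  filter_upwards [st_base_lower hα e, eventually_gt_atTop 0] with x h hx
  rw [show α / 2 = α * (1 / 2) by ring, rpow_mul hx.le, ← mul_rpow (by norm_num) (by positivity)]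
  exact rpow_le_rpow (by positivity) h (by norm_num)

lemma stG_eq {α x0 M x : ℝ} (h : x0 + 1 ≤ x) :
    stG α x0 M x = ((2 - α) + 4 * (log x)⁻¹) * ((x ^ α + M) ^ (1 / 2 : ℝ) * x ^ (-1 : ℝ)) := by
  unfold stG
  rw [stM_eq h, Real.smoothTransition.one_of_one_le (by linarith), rpow_neg_one, one_mul,
    div_eq_mul_inv, div_eq_mul_inv]

lemma stG_sym {α : ℝ} (hα : 0 < α) (x0 M : ℝ) : StSym (α / 2 - 1) (stG α x0 M) := by
  have h := ((StSym.const (2 - α)).add (StSym.inv_log.const_mul 4)).mul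
    ((st_sym_sqrt hα M).mul (StSym.rpow (-1)))
  rw [show 0 + (α / 2 + -1) = α / 2 - 1 by ring] at h
  refine h.congr ?_
  filter_upwards [eventually_ge_atTop (x0 + 1)] with x hx
  exact stG_eq hx

lemma stS_sq {α x0 e x : ℝ} (h : x0 + 1 ≤ x) (hb : 0 ≤ x ^ α + e) :
    stS α x0 e x ^ 2 = (x ^ α + e) ^ (1 / 2 : ℝ) := by
  unfold stS
  rw [stM_eq h, ← rpow_natCast, ← rpow_mul hb]
  norm_num

lemma stS_log_deriv {α : ℝ} (hα : 0 < α) (x0 e : ℝ) :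
    StSym (-1) (fun x => deriv (stS α x0 e) x / stS α x0 e x) := by
  have h := ((StSym.rpow (α - 1)).mul ((st_sym_base hα e).inv (by norm_num) (st_base_lower hα e))).const_mul (α / 4)
  rw [show α - 1 + -α = -1 by ring] at h
  refine h.congr ?_
  filter_upwards [eventually_gt_atTop (x0 + 1), eventually_gt_atTop 0, st_base_lower hα e] with x hx hx0 hb
  have hpos : 0 < x ^ α + e := lt_of_lt_of_le (by positivity) hb
  have hd : HasDerivAt (fun x : ℝ => (x ^ α + e) ^ (1 / 4 : ℝ))
      (α * x ^ (α - 1) * (1 / 4) * (x ^ α + e) ^ ((1 / 4 : ℝ) - 1)) x :=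
    ((hasDerivAt_rpow_const (Or.inl hx0.ne')).add_const e).rpow_const (Or.inl hpos.ne')
  have heq : stS α x0 e =ᶠ[nhds x] fun x : ℝ => (x ^ α + e) ^ (1 / 4 : ℝ) := by
    filter_upwards [Ioi_mem_nhds hx] with y hy
    unfold stS
    rw [stM_eq (le_of_lt hy)]
  rw [heq.deriv_eq, hd.deriv, heq.eq_of_nhds, rpow_sub_one hpos.ne']
  have : (x ^ α + e) ^ (1 / 4 : ℝ) ≠ 0 := (rpow_pos_of_pos hpos _).ne'
  field_simp

lemma st_limsup {α x0 M : ℝ} (hα : 0 < α) (N : ℕ) {q : ℝ → ℝ} 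
    (hq : ∀ x, |q x| ≤ |stG α x0 M x| * N) (hα2 : α < 2) (hM : 0 ≤ M) :
    limsup (fun x : ℝ => x ^ (1 - α / 2) * |q x|) atTop ≤ (2 - α) * N := by
  have hlim : Tendsto (fun x : ℝ => ((2 - α) + 4 * (log x)⁻¹) * (1 + M * x ^ (-α)) ^ (1 / 2 : ℝ) * N) atTop
      (nhds ((2 - α) * N)) := by
    have h1 : Tendsto (fun x : ℝ => (2 - α) + 4 * (log x)⁻¹) atTop (nhds (2 - α)) := by
      have := (tendsto_inv_atTop_zero.comp tendsto_log_atTop).const_mul (4:ℝ)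
      simpa using this.const_add (2 - α)
    have h2 : Tendsto (fun x : ℝ => (1 + M * x ^ (-α)) ^ (1 / 2 : ℝ)) atTop (nhds 1) := by
      have := ((tendsto_rpow_neg_atTop hα).const_mul M).const_add 1
      have := this.rpow_const (p := (1 / 2 : ℝ)) (Or.inr (by norm_num))
      simpa using this
    simpa using (h1.mul h2).mul_const (N : ℝ)
  rw [← hlim.limsup_eq]
  refine limsup_le_limsup ?_ ?_ hlim.isBoundedUnder_le
  · filter_upwards [eventually_ge_atTop (x0 + 1), eventually_gt_atTop 0,
      tendsto_log_atTop.eventually_gt_atTop 0] with x hx hx0 hl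
    have e : x ^ (1 - α / 2) * stG α x0 M x =
        ((2 - α) + 4 * (log x)⁻¹) * (1 + M * x ^ (-α)) ^ (1 / 2 : ℝ) := by
      rw [stG_eq hx]
      have a : x ^ α + M = x ^ α * (1 + M * x ^ (-α)) := by
        rw [rpow_neg hx0.le]; field_simp
      rw [a, mul_rpow (by positivity) (by positivity), ← rpow_mul hx0.le]
      have b : x ^ (1 - α / 2) * (x ^ (α * (1 / 2)) * x ^ (-1 : ℝ)) = 1 := by
        rw [← rpow_add hx0, ← rpow_add hx0]; ring_nf; exact rpow_zero x
      linear_combination (((2 - α) + 4 * (log x)⁻¹) * (1 + M * x ^ (-α)) ^ (1 / 2 : ℝ)) * b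
    have hg : 0 ≤ stG α x0 M x := by
      rw [stG_eq hx]
      have : 0 < 2 - α := by linarith
      positivity
    have h := hq x
    rw [abs_of_nonneg hg] at h
    show x ^ (1 - α / 2) * |q x| ≤ _
    rw [← e, mul_assoc]
    gcongr
  · refine IsBoundedUnder.isCoboundedUnder_le ⟨0, ?_⟩
    simp only [eventually_map]
    filter_upwards [eventually_ge_atTop 0] with x hx
    show 0 ≤ x ^ (1 - α / 2) * |q x|
    positivity

theorem stark_N_eigenvalues
    (α : ℝ) (hα0 : 0 < α) (hα2 : α < 2)
    (N : ℕ) (hN : 1 ≤ N) (E : Fin N → ℝ) (hE : Function.Injective E)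
    (θ : Fin N → ℝ) (hθ : ∀ j, θ j ∈ Set.Icc 0 Real.pi) :
    ∃ q : ℝ → ℝ, ContDiffOn ℝ (⊤ : ℕ∞) q (Set.Ici 0) ∧
      Filter.limsup (fun x : ℝ => x ^ (1 - α / 2) * |q x|) Filter.atTop
        ≤ (2 - α) * Real.exp (2 * Real.sqrt (Real.log N)) * N ∧
      ∀ j : Fin N, ∃ u : ℝ → ℝ, ContDiffOn ℝ 2 u (Set.Ici 0) ∧
        (∀ x : ℝ, 0 < x →
          -(deriv (deriv u) x) - x ^ α * u x + q x * u x = E j * u x) ∧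
        (∃ x ∈ Set.Ici (0 : ℝ), u x ≠ 0) ∧
        MeasureTheory.IntegrableOn (fun x => (u x) ^ 2) (Set.Ioi 0) ∧
        deriv u 0 * Real.cos (θ j) = u 0 * Real.sin (θ j) := by
  set M : ℝ := ∑ i, |E i| with hM
  have hM0 : 0 ≤ M := Finset.sum_nonneg fun i _ => abs_nonneg _
  have hEM : ∀ j, |E j| ≤ M := fun j =>
    Finset.single_le_sum (f := fun i => |E i|) (fun i _ => abs_nonneg _) (Finset.mem_univ j)
  obtain ⟨x0, hx0M, hx02⟩ := (((tendsto_rpow_atTop hα0).eventually_ge_atTop (M + 1)).and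
    (eventually_ge_atTop 2)).exists
  have hEl : ∀ j, -M ≤ E j := fun j => (abs_le.1 (hEM j)).1
  have hEu : ∀ j, E j ≤ M := fun j => (abs_le.1 (hEM j)).2
  obtain ⟨φ, q, hq, hqs, hall⟩ := st_core α hα0 E θ (fun j => stS α x0 (E j)) (stG α x0 M) x0
    (by linarith) (fun j => stS_contDiff hα0 hx02 hx0M (hEl j))
    (fun j x => rpow_pos_of_pos (by linarith [st_base_ge hα0 hx02 hx0M (hEl j) x]) _)
    (stG_contDiff hα0 hx02 hx0M hM0)
    (fun x hx => by
      unfold stG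
      rw [Real.smoothTransition.zero_of_nonpos (by linarith)]; simp)
  have hq' : ∀ x, q x = - stG α x0 M x * ∑ i, sin (2 * φ i x) := by
    intro x
    rw [hq]
    simp only [sin_two_mul, mul_assoc]
  have hqb : ∀ x, |q x| ≤ |stG α x0 M x| * N := by
    intro x
    rw [hq', abs_mul, abs_neg]
    gcongr
    refine (Finset.abs_sum_le_sum_abs _ _).trans ?_
    refine (Finset.sum_le_sum fun i _ => abs_sin_le_one _).trans ?_
    simp
  refine ⟨q, hqs.contDiffOn, ?_, ?_⟩
  · refine (st_limsup hα0 N hqb hα2 hM0).trans ?_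
    have h1 : 1 ≤ exp (2 * √(log N)) := one_le_exp (by positivity)
    have h2 : 0 < 2 - α := by linarith
    have h3 : (0:ℝ) ≤ N := by positivity
    have : (2 - α) * 1 ≤ (2 - α) * exp (2 * √(log N)) := by gcongr
    nlinarith
  -- asymptotic facts
  have hbig : ∀ᶠ x : ℝ in atTop, x0 + 1 ≤ x := eventually_ge_atTop _
  have hbase : ∀ i, ∀ x, x0 + 1 ≤ x → 1 ≤ x ^ α + E i := by
    intro i x hx
    have := st_base_ge hα0 hx02 hx0M (hEl i) x
    rwa [stM_eq hx] at this
  set p : Fin N → ℝ → ℝ := fun i x => (x ^ α + E i) ^ (1 / 2 : ℝ) with hp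
  have hps : ∀ i, StSym (α / 2) (p i) := fun i => st_sym_sqrt hα0 (E i)
  have hpl : ∀ i, ∀ᶠ x in atTop, (1 / 2 : ℝ) ^ (1 / 2 : ℝ) * x ^ (α / 2) ≤ p i x :=
    fun i => st_sqrt_lower hα0 (E i)
  have hc : (0:ℝ) < (1 / 2 : ℝ) ^ (1 / 2 : ℝ) := by positivity
  have hp2 : ∀ i x, x0 + 1 ≤ x → p i x ^ 2 = x ^ α + E i := by
    intro i x hx
    simp only [hp]
    rw [← rpow_natCast, ← rpow_mul (by linarith [hbase i x hx])]
    norm_num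
  have hpp : ∀ i x, x0 + 1 ≤ x → 0 < p i x := fun i x hx =>
    rpow_pos_of_pos (by linarith [hbase i x hx]) _
  have hsp : ∀ i x, x0 + 1 ≤ x → stS α x0 (E i) x ^ 2 = p i x := fun i x hx =>
    stS_sq hx (by linarith [hbase i x hx])
  set k : Fin N → ℝ → ℝ := fun i x => deriv (stS α x0 (E i)) x / stS α x0 (E i) x with hk
  have hks : ∀ i, StSym (-1) (k i) := fun i => stS_log_deriv hα0 x0 (E i)
  have hgs := stG_sym hα0 x0 M
  set e : Fin N → ℝ → ℝ := fun i x => - (q x / p i x) * sin (φ i x) ^ 2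
    + 2 * k i x * (sin (φ i x) * cos (φ i x)) with he
  have heb : ∀ i, ∃ C, ∀ᶠ x in atTop, |e i x| ≤ C * x⁻¹ := by
    intro i
    have h1 := hgs.mul ((hps i).inv hc (hpl i))
    rw [show α / 2 - 1 + -(α / 2) = -1 by ring] at h1
    obtain ⟨_, C1, hC1, h1⟩ := h1
    obtain ⟨_, C2, hC2, h2⟩ := hks i
    refine ⟨C1 * N + C2, ?_⟩
    filter_upwards [h1, h2, hbig] with x ⟨_, a1, _⟩ ⟨_, a2, _⟩ hx
    have hpx := hpp i x hx
    rw [rpow_neg_one] at a1 a2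
    simp only [he]
    have b1 : |-(q x / p i x) * sin (φ i x) ^ 2| ≤ C1 * x⁻¹ * N := by
      rw [abs_mul, abs_neg, abs_div, abs_of_pos hpx, abs_of_nonneg (sq_nonneg (sin (φ i x)))]
      rw [abs_mul, abs_inv, abs_of_pos hpx] at a1
      calc |q x| / p i x * sin (φ i x) ^ 2 ≤ |q x| / p i x * 1 := by
            gcongr; exact sin_sq_le_one _
        _ ≤ |stG α x0 M x| * N / p i x := by rw [mul_one]; gcongr; exact hqb x
        _ = |stG α x0 M x| * (p i x)⁻¹ * N := by ring
        _ ≤ _ := by gcongr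
    have b2 : |2 * k i x * (sin (φ i x) * cos (φ i x))| ≤ C2 * x⁻¹ := by
      rw [show 2 * k i x * (sin (φ i x) * cos (φ i x)) = k i x * sin (2 * φ i x) by
        rw [sin_two_mul]; ring, abs_mul]
      calc _ ≤ |k i x| * 1 := by gcongr; exact abs_sin_le_one _
        _ ≤ _ := by rw [mul_one]; exact a2
    refine (abs_add_le _ _).trans ?_
    linarith
  choose Ce hCe using heb
  have hCe' : ∀ i, ∀ᶠ x in atTop, |e i x| ≤ (∑ l, |Ce l|) * x⁻¹ := by
    intro i
    filter_upwards [hCe i, eventually_gt_atTop 0] with x h hx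
    refine h.trans ?_
    gcongr
    exact (le_abs_self _).trans
      (Finset.single_le_sum (f := fun l => |Ce l|) (fun _ _ => abs_nonneg _) (Finset.mem_univ i))
  have hφd : ∀ i, ∀ᶠ x in atTop, HasDerivAt (φ i) (p i x + e i x) x := by
    intro i
    filter_upwards [hbig] with x hx
    refine ((hall i).1 x).congr_deriv ?_
    have hpx := hpp i x hx
    rw [hsp i x hx, ← hp2 i x hx]
    simp only [he, hk]
    rw [cos_sq']
    field_simp
    ring
  intro j
  obtain ⟨-, L, u, hu, hL, hu2, heq, hnz, hbc⟩ := hall j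
  refine ⟨u, hu2.contDiffOn, fun x _ => heq x, hnz, ?_, hbc⟩
  obtain ⟨C, hC⟩ := st_decay hα0 hα2 hE hc hps hpl (hks j) hgs
    (fun i l => by
      filter_upwards [hbig] with x hx
      rw [hp2 i x hx, hp2 l x hx]; ring) hφd hCe' j (Eventually.of_forall hL)
    (by
      filter_upwards [hbig] with x hx
      have hpx := hpp j x hx
      rw [hsp j x hx, ← hp2 j x hx, hq', sin_two_mul (φ j x), cos_two_mul, sin_sq]
      simp only [hk]
      field_simp
      ring)
    (by
      filter_upwards [hbig, eventually_gt_atTop 0, tendsto_log_atTop.eventually_gt_atTop 0]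
        with x hx hx0 hl
      have hpx := hpp j x hx
      rw [stG_eq hx, rpow_neg_one]
      have h1 : p j x ≤ (x ^ α + M) ^ (1 / 2 : ℝ) :=
        rpow_le_rpow (by linarith [hbase j x hx]) (by linarith [hEu j]) (by norm_num)
      have h2 : 0 < 2 - α := by linarith
      have h3 : 1 ≤ (x ^ α + M) ^ (1 / 2 : ℝ) / p j x := (one_le_div hpx).2 h1
      have h4 : ((2 - α) + 4 * (log x)⁻¹) * ((x ^ α + M) ^ (1 / 2 : ℝ) * x⁻¹) / (4 * p j x) =
          ((2 - α) + 4 / log x) / (4 * x) * ((x ^ α + M) ^ (1 / 2 : ℝ) / p j x) := by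
        field_simp
      rw [h4]
      exact le_mul_of_one_le_right (by positivity) h3)
  exact st_integrable hc hu2.continuous hu
    (by
      filter_upwards [hbig, hpl j] with x hx h
      rwa [hsp j x hx]) hC
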